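/- The function G₁ defined by the explicit formula G₁(ξ) = −exp(∫₀^ξ η/(2P'(v̄(η))) dη) · ∫₀^ξ exp(−∫₀^η ζ/(2P'(v̄(ζ))) dζ) · (η v̄'(η)/2) dη satisfies the first-order linear ODE P'(v̄(ξ)) G₁'(ξ) − (1/2) ξ G₁(ξ) + (1/2) ξ (d/dξ) P(v̄(ξ)) = 0 for all ξ ∈ ℝ; consequently, the source term satisfies the exact decomposition S[v_*](x,t) = ∂_x g₂(x,t) + ∂_t g₃(x,t) for all x ∈ ℝ, t ≥ 0. -/

import Mathlib

open MeasureTheory Real Filter Function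
open scoped ENNReal Topology

noncomputable section

/-- The self-similar variable `ξ = x / √(1+t)`. -/
def xiVar (x t : ℝ) : ℝ := x / Real.sqrt (1 + t)

/-- Partial derivative in the first (spatial) variable of a function of `(x, t)`. -/
def pdx (f : ℝ → ℝ → ℝ) : ℝ → ℝ → ℝ := fun x t => deriv (fun x' => f x' t) x

/-- Partial derivative in the second (time) variable of a function of `(x, t)`. -/
def pdt (f : ℝ → ℝ → ℝ) : ℝ → ℝ → ℝ := fun x t => deriv (fun t' => f x t') t

/-- The function `G₁` from the paper, defined by the explicit integral formula. -/
def G1fun (P vbar : ℝ → ℝ) (ξ : ℝ) : ℝ :=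
  -(Real.exp (∫ η in (0:ℝ)..ξ, η / (2 * deriv P (vbar η))) *
    ∫ η in (0:ℝ)..ξ,
      Real.exp (-∫ ζ in (0:ℝ)..η, ζ / (2 * deriv P (vbar ζ))) * (η * deriv vbar η / 2))

/-- `v₁ = G₁'`. -/
def v1fun (P vbar : ℝ → ℝ) : ℝ → ℝ := deriv (G1fun P vbar)

/-- `u₁(ξ) = -(1/2) (ξ G₁(ξ))'`. -/
def u1fun (P vbar : ℝ → ℝ) (ξ : ℝ) : ℝ :=
  -(1/2) * deriv (fun η => η * G1fun P vbar η) ξ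

/-- The diffusion-wave velocity `ū(x,t) = -(1+t)^{-1/2} (d/dξ) P(v̄(ξ))`, `ξ = x/√(1+t)`. -/
def ubarFun (P vbar : ℝ → ℝ) (x t : ℝ) : ℝ :=
  -((1 + t) ^ (-(1/2) : ℝ) * deriv (fun η => P (vbar η)) (xiVar x t))

/-- The asymptotic profile `v_*(x,t) = v̄(ξ) + (1+t)⁻¹ v₁(ξ)`. -/
def vstarFun (P vbar : ℝ → ℝ) (x t : ℝ) : ℝ :=
  vbar (xiVar x t) + (1 + t)⁻¹ * v1fun P vbar (xiVar x t)

/-- The asymptotic profile `u_*(x,t) = ū(x,t) + (1+t)^{-3/2} u₁(ξ)`. -/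
def ustarFun (P vbar : ℝ → ℝ) (x t : ℝ) : ℝ :=
  ubarFun P vbar x t + (1 + t) ^ (-(3/2) : ℝ) * u1fun P vbar (xiVar x t)

/-- The source term `S[v_*] = ∂_t u_* + ∂_x P(v_*) + u_*`. -/
def Ssrc (P vbar : ℝ → ℝ) (x t : ℝ) : ℝ :=
  pdt (ustarFun P vbar) x t
    + pdx (fun x' t' => P (vstarFun P vbar x' t')) x t
    + ustarFun P vbar x t

/-- `g₂ = P(v_*) − P(v̄) − P'(v̄)(v_* − v̄)`. -/
def g2fun (P vbar : ℝ → ℝ) (x t : ℝ) : ℝ :=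
  P (vstarFun P vbar x t) - P (vbar (xiVar x t))
    - deriv P (vbar (xiVar x t)) * (vstarFun P vbar x t - vbar (xiVar x t))

/-- `g₃ = (1+t)^{-3/2} u₁(ξ)`. -/
def g3fun (P vbar : ℝ → ℝ) (x t : ℝ) : ℝ :=
  (1 + t) ^ (-(3/2) : ℝ) * u1fun P vbar (xiVar x t)

/-- Non-degeneracy on the right half line. -/
theorem halfline_neg (v f q W : ℝ → ℝ) (p : ℝ → ℝ) (L : ℝ)
    (hp : Continuous p) (hq : ∀ ξ, q ξ = p (v ξ))
    (hv : ∀ ξ, HasDerivAt v (f ξ) ξ) (hWq : ∀ ξ, W ξ = q ξ * f ξ)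
    (hW : ∀ ξ, HasDerivAt W (ξ / 2 * f ξ) ξ)
    (hfc : Continuous f) (hlim : Tendsto v atTop (nhds L)) (hL : p L < 0) :
    ∀ ξ, 0 ≤ ξ → q ξ < 0 := by
  intro ξ0 hξ0
  by_contra hcon
  push Not at hcon
  have hvc : Continuous v := continuous_iff_continuousAt.2 fun ξ => (hv ξ).continuousAt
  have hqc : Continuous q := by
    have : q = fun ξ => p (v ξ) := funext hq
    rw [this]; exact hp.comp hvc
  have hWc : Continuous W := continuous_iff_continuousAt.2 fun ξ => (hW ξ).continuousAt
  have hev : ∀ᶠ ξ in atTop, q ξ < 0 := by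
    have h1 : Tendsto (fun ξ => p (v ξ)) atTop (nhds (p L)) := (hp.tendsto L).comp hlim
    filter_upwards [h1.eventually_lt_const hL] with ξ h
    rw [hq]; exact h
  obtain ⟨B, hB⟩ := eventually_atTop.1 hev
  set S : Set ℝ := {ξ | 0 ≤ ξ ∧ 0 ≤ q ξ} with hS
  have hSc : IsClosed S :=
    (isClosed_le continuous_const continuous_id).inter (isClosed_le continuous_const hqc)
  have hSn : S.Nonempty := ⟨ξ0, hξ0, hcon⟩
  have hSb : BddAbove S := ⟨B, fun y hy => by
    by_contra h
    push Not at h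
    exact absurd (hB y h.le) (not_lt.2 hy.2)⟩
  have haS : sSup S ∈ S := hSc.csSup_mem hSn hSb
  set a := sSup S with ha
  have ha0 : 0 ≤ a := haS.1
  have hneg : ∀ ξ, a < ξ → q ξ < 0 := by
    intro ξ h
    by_contra h2
    push Not at h2
    exact absurd (le_csSup hSb (show ξ ∈ S from ⟨ha0.trans h.le, h2⟩)) (not_le.2 h)
  have hqa : q a = 0 := by
    refine le_antisymm ?_ haS.2
    have h1 : Tendsto q (nhdsWithin a (Set.Ioi a)) (nhds (q a)) :=
      (hqc.tendsto a).mono_left nhdsWithin_le_nhds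
    refine le_of_tendsto h1 ?_
    filter_upwards [self_mem_nhdsWithin] with ξ h
    exact (hneg ξ h).le
  have hWa : W a = 0 := by rw [hWq, hqa, zero_mul]
  have hanti : AntitoneOn (fun ξ => W ξ ^ 2) (Set.Ici a) := by
    refine antitoneOn_of_deriv_nonpos (convex_Ici a) (hWc.pow 2).continuousOn ?_ ?_
    · intro ξ _
      exact ((hW ξ).pow 2).differentiableAt.differentiableWithinAt
    · intro ξ h
      rw [interior_Ici] at h
      have hd := ((hW ξ).pow 2).deriv
      have he : deriv (fun ξ => W ξ ^ 2) ξ = q ξ * (ξ * f ξ ^ 2) := by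
        refine (Eq.trans ?_ hd).trans ?_
        · rfl
        · rw [hWq]; push_cast; ring
      rw [he]
      have : 0 ≤ ξ := ha0.trans (le_of_lt h)
      exact mul_nonpos_of_nonpos_of_nonneg (hneg ξ h).le (by positivity)
  have hW0 : ∀ ξ, a < ξ → W ξ = 0 := by
    intro ξ h
    have := hanti (Set.mem_Ici.2 le_rfl) (Set.mem_Ici.2 h.le) h.le
    simp only [hWa] at this
    have h2 : W ξ ^ 2 = 0 := le_antisymm (by simpa using this) (sq_nonneg _)
    exact pow_eq_zero_iff (two_ne_zero) |>.1 h2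
  have hf0 : ∀ ξ, a < ξ → f ξ = 0 := by
    intro ξ h
    have h1 := hW0 ξ h
    rw [hWq] at h1
    exact (mul_eq_zero.1 h1).resolve_left (hneg ξ h).ne
  have hconst : ∀ ξ, a ≤ ξ → v ξ = v a := by
    intro ξ h
    refine constant_of_has_deriv_right_zero (a := a) (b := ξ) hvc.continuousOn ?_ ξ ⟨h, le_rfl⟩
    intro y hy
    have hfy : f y = 0 := by
      rcases hy.1.eq_or_lt with h1 | h1
      · subst h1
        have h1 : Tendsto f (nhdsWithin a (Set.Ioi a)) (nhds (f a)) :=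
          (hfc.tendsto a).mono_left nhdsWithin_le_nhds
        refine tendsto_nhds_unique h1 (tendsto_const_nhds.congr' ?_)
        filter_upwards [self_mem_nhdsWithin] with z hz
        exact (hf0 z hz).symm
      · exact hf0 y h1
    have := (hv y).hasDerivWithinAt (s := Set.Ici y)
    rwa [hfy] at this
  have hva : v a = L := by
    refine tendsto_nhds_unique (tendsto_const_nhds.congr' ?_) hlim
    filter_upwards [eventually_ge_atTop a] with ξ h
    exact (hconst ξ h).symm
  rw [hq, hva] at hqa
  exact hL.ne hqa

theorem G1_hasDerivAt (P vbar : ℝ → ℝ) (hpc : Continuous fun η => deriv P (vbar η))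
    (hne : ∀ η, deriv P (vbar η) ≠ 0) (hfc : Continuous (deriv vbar)) (ξ : ℝ) :
    HasDerivAt (G1fun P vbar)
      (ξ / (2 * deriv P (vbar ξ)) * G1fun P vbar ξ - ξ * deriv vbar ξ / 2) ξ := by
  have hac : Continuous fun η => η / (2 * deriv P (vbar η)) :=
    continuous_id.div (continuous_const.mul hpc) fun η => mul_ne_zero two_ne_zero (hne η)
  have hA : ∀ ξ, HasDerivAt (fun ξ => ∫ η in (0:ℝ)..ξ, η / (2 * deriv P (vbar η)))
      (ξ / (2 * deriv P (vbar ξ))) ξ := fun ξ => hac.integral_hasStrictDerivAt 0 ξ |>.hasDerivAt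
  have hAc : Continuous (fun ξ => ∫ η in (0:ℝ)..ξ, η / (2 * deriv P (vbar η))) :=
    continuous_iff_continuousAt.2 fun ξ => (hA ξ).continuousAt
  have hbc : Continuous fun η : ℝ =>
      Real.exp (-∫ ζ in (0:ℝ)..η, ζ / (2 * deriv P (vbar ζ))) * (η * deriv vbar η / 2) :=
    (Real.continuous_exp.comp hAc.neg).mul ((continuous_id.mul hfc).div_const 2)
  have hI := (hbc.integral_hasStrictDerivAt 0 ξ).hasDerivAt
  have h := ((hA ξ).exp.mul hI).neg
  unfold G1fun
  refine h.congr_deriv ?_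
  rw [Real.exp_neg]
  field_simp [(Real.exp_pos _).ne']
  ring

/-- `G₁` solves the first-order linear ODE `P'(v̄)G₁' − (1/2)ξG₁ + (1/2)ξ(P(v̄))' = 0`,
and consequently the source term decomposes exactly as `S[v_*] = ∂ₓg₂ + ∂ₜg₃`. -/
theorem G1_ode_and_source_decomposition
    (vminus vplus : ℝ) (hvm : 0 < vminus) (hvp : 0 < vplus)
    (P : ℝ → ℝ) (hP : ContDiff ℝ (⊤ : ℕ∞) P)
    (hPpos : ∀ w ∈ Set.uIcc vminus vplus, 0 < P w)
    (hPder : ∀ w ∈ Set.uIcc vminus vplus, deriv P w < 0)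
    (vbar : ℝ → ℝ) (hvbar : ContDiff ℝ (⊤ : ℕ∞) vbar)
    (hode : ∀ ξ : ℝ, (1/2) * ξ * deriv vbar ξ = deriv (deriv (fun η => P (vbar η))) ξ)
    (hlimp : Tendsto vbar atTop (nhds vplus))
    (hlimm : Tendsto vbar atBot (nhds vminus)) :
    (∀ ξ : ℝ,
      deriv P (vbar ξ) * deriv (G1fun P vbar) ξ
        - (1/2) * ξ * G1fun P vbar ξ
        + (1/2) * ξ * deriv (fun η => P (vbar η)) ξ = 0) ∧
    (∀ x t : ℝ, 0 ≤ t →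
      Ssrc P vbar x t = pdx (g2fun P vbar) x t + pdt (g3fun P vbar) x t) := by
  have hdP : ContDiff ℝ (⊤ : ℕ∞) (deriv P) := (contDiff_infty_iff_deriv.1 hP).2
  have hdv : ContDiff ℝ (⊤ : ℕ∞) (deriv vbar) := (contDiff_infty_iff_deriv.1 hvbar).2
  have hPd : Differentiable ℝ P := (contDiff_infty_iff_deriv.1 hP).1
  have hvd : Differentiable ℝ vbar := (contDiff_infty_iff_deriv.1 hvbar).1
  have hdPd : Differentiable ℝ (deriv P) := (contDiff_infty_iff_deriv.1 hdP).1
  have hdvd : Differentiable ℝ (deriv vbar) := (contDiff_infty_iff_deriv.1 hdv).1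
  have hw : ∀ ξ, HasDerivAt (fun η => P (vbar η)) (deriv P (vbar ξ) * deriv vbar ξ) ξ :=
    fun ξ => (hPd (vbar ξ)).hasDerivAt.comp ξ (hvd ξ).hasDerivAt
  have hWq : ∀ ξ, deriv (fun η => P (vbar η)) ξ = deriv P (vbar ξ) * deriv vbar ξ :=
    fun ξ => (hw ξ).deriv
  set W := deriv (fun η => P (vbar η)) with hWdef
  have hqd : Differentiable ℝ (fun ξ => deriv P (vbar ξ)) := hdPd.comp hvd
  have hWd : Differentiable ℝ W := by
    have : W = fun ξ => deriv P (vbar ξ) * deriv vbar ξ := funext hWq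
    rw [this]; exact hqd.mul hdvd
  have hW : ∀ ξ, HasDerivAt W (ξ / 2 * deriv vbar ξ) ξ := fun ξ => by
    have h := (hWd ξ).hasDerivAt
    rw [← hode ξ] at h
    exact h.congr_deriv (by ring)
  have hneg : ∀ ξ, deriv P (vbar ξ) < 0 := by
    intro ξ
    rcases le_total 0 ξ with h | h
    · exact halfline_neg vbar (deriv vbar) (fun ξ => deriv P (vbar ξ)) W (deriv P) vplus
        hdPd.continuous (fun _ => rfl) (fun ξ => (hvd ξ).hasDerivAt) hWq hW hdvd.continuous hlimp
        (hPder _ Set.right_mem_uIcc) ξ h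
    · have := halfline_neg (fun ξ => vbar (-ξ)) (fun ξ => -deriv vbar (-ξ))
        (fun ξ => deriv P (vbar (-ξ))) (fun ξ => -W (-ξ)) (deriv P) vminus
        hdPd.continuous (fun _ => rfl)
        (fun ξ => ((hvd (-ξ)).hasDerivAt.comp ξ (hasDerivAt_neg ξ)).congr_deriv (by ring))
        (fun ξ => by rw [hWq]; ring)
        (fun ξ => ((hW (-ξ)).comp ξ (hasDerivAt_neg ξ)).neg.congr_deriv (by ring))
        (hdvd.continuous.comp continuous_neg).neg (hlimm.comp tendsto_neg_atTop_atBot)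
        (hPder _ Set.left_mem_uIcc) (-ξ) (by linarith)
      simpa using this
  have hne : ∀ ξ, deriv P (vbar ξ) ≠ 0 := fun ξ => (hneg ξ).ne
  have hG := G1_hasDerivAt P vbar hqd.continuous hne hdvd.continuous
  set G := G1fun P vbar with hGdef
  have hG' : ∀ ξ, deriv G ξ = ξ / (2 * deriv P (vbar ξ)) * G ξ - ξ * deriv vbar ξ / 2 :=
    fun ξ => (hG ξ).deriv
  have hGd : Differentiable ℝ G := fun ξ => (hG ξ).differentiableAt
  have hG'd : Differentiable ℝ (deriv G) := by
    rw [funext hG']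
    exact ((differentiable_id.div (hqd.const_mul 2) fun ξ => mul_ne_zero two_ne_zero (hne ξ)).mul
      hGd).sub ((differentiable_id.mul hdvd).div_const 2)
  have hfirst : ∀ ξ : ℝ, deriv P (vbar ξ) * deriv G ξ - (1/2) * ξ * G ξ
      + (1/2) * ξ * W ξ = 0 := by
    intro ξ
    rw [hG', hWq]
    have := hne ξ
    field_simp
    ring
  refine ⟨hfirst, ?_⟩
  intro x t ht
  have hu1 : ∀ ξ, u1fun P vbar ξ = -(1/2) * (G ξ + ξ * deriv G ξ) := by
    intro ξ
    have h : HasDerivAt (fun η => η * G η) (1 * G ξ + ξ * deriv G ξ) ξ :=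
      (hasDerivAt_id ξ).mul (hGd ξ).hasDerivAt
    unfold u1fun
    rw [← hGdef, h.deriv]; ring
  have hu1d : Differentiable ℝ (u1fun P vbar) := by
    rw [funext hu1]
    exact (hGd.add (differentiable_id.mul hG'd)).const_mul _
  -- the product `P'(v̄) v₁`
  have hQ : ∀ ξ, HasDerivAt (fun η => deriv P (vbar η) * deriv G η)
      ((1/2) * (G ξ + ξ * deriv G ξ) - (1/2) * (W ξ + ξ * (ξ / 2 * deriv vbar ξ))) ξ := by
    intro ξ
    have he : (fun η => deriv P (vbar η) * deriv G η)
        = fun η => (1/2) * (η * G η) - (1/2) * (η * W η) := by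
      funext η; linarith [hfirst η]
    rw [he]
    have h1 : HasDerivAt (fun η => η * G η) (1 * G ξ + ξ * deriv G ξ) ξ :=
      (hasDerivAt_id ξ).mul (hGd ξ).hasDerivAt
    have h2 : HasDerivAt (fun η => η * W η) (1 * W ξ + ξ * (ξ / 2 * deriv vbar ξ)) ξ :=
      (hasDerivAt_id ξ).mul (hW ξ)
    exact ((h1.const_mul (1/2)).sub (h2.const_mul (1/2))).congr_deriv (by ring)
  have hs : 0 < 1 + t := by linarith
  obtain ⟨r, hr⟩ : ∃ r, r = Real.sqrt (1 + t) := ⟨_, rfl⟩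
  have hr0 : 0 < r := hr ▸ Real.sqrt_pos.2 hs
  have hrs : 1 + t = r ^ 2 := by rw [hr, Real.sq_sqrt hs.le]
  have hp1 : (1 + t) ^ (-(1/2) : ℝ) = r⁻¹ := by
    rw [Real.rpow_neg hs.le, ← Real.sqrt_eq_rpow, hr]
  have hp3 : (1 + t) ^ (-(3/2) : ℝ) = (r⁻¹) ^ 3 := by
    rw [← hp1, ← Real.rpow_natCast, ← Real.rpow_mul hs.le]; norm_num
  have hadd : HasDerivAt (fun t' : ℝ => 1 + t') 1 t := (hasDerivAt_id t).const_add 1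
  have hxt : HasDerivAt (fun t' => xiVar x t') (-(x / (2 * r ^ 3))) t := by
    unfold xiVar
    have h := (hadd.sqrt hs.ne').inv (Real.sqrt_pos.2 hs).ne' |>.const_mul x
    refine h.congr_deriv ?_
    rw [← hr]; field_simp
  have hxx : HasDerivAt (fun x' => xiVar x' t) r⁻¹ x := by
    unfold xiVar
    rw [← hr]
    exact ((hasDerivAt_id x).div_const r).congr_deriv (by ring)
  have hpow1 : HasDerivAt (fun t' : ℝ => (1 + t') ^ (-(1/2) : ℝ)) (-(1/2) * (r⁻¹) ^ 3) t := by
    have h := hadd.rpow_const (p := (-(1/2) : ℝ)) (Or.inl hs.ne')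
    refine h.congr_deriv ?_
    rw [← hp3]; norm_num
  have hpow3 : DifferentiableAt ℝ (fun t' : ℝ => (1 + t') ^ (-(3/2) : ℝ)) t :=
    (hadd.rpow_const (p := (-(3/2) : ℝ)) (Or.inl hs.ne')).differentiableAt
  obtain ⟨ξ, hξ⟩ : ∃ ξ, ξ = xiVar x t := ⟨_, rfl⟩
  have hxr : x = ξ * r := by rw [hξ]; unfold xiVar; rw [← hr]; field_simp
  have hub : HasDerivAt (fun t' => ubarFun P vbar x t')
      ((1/2) * (r⁻¹) ^ 3 * (W ξ + ξ * (ξ / 2 * deriv vbar ξ))) t := by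
    have h := (hpow1.mul ((hW (xiVar x t)).comp t hxt)).neg
    unfold ubarFun
    refine h.congr_deriv ?_
    simp only [Function.comp, ← hξ, hp1]
    rw [hxr]
    field_simp
    ring
  have hg3 : DifferentiableAt ℝ (fun t' => g3fun P vbar x t') t :=
    hpow3.mul ((hu1d (xiVar x t)).comp t hxt.differentiableAt)
  have hut : pdt (ustarFun P vbar) x t
      = (1/2) * (r⁻¹) ^ 3 * (W ξ + ξ * (ξ / 2 * deriv vbar ξ)) + pdt (g3fun P vbar) x t := by
    unfold pdt
    exact (hub.add hg3.hasDerivAt).deriv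
  have hvs : DifferentiableAt ℝ (fun x' => vstarFun P vbar x' t) x :=
    ((hvd (xiVar x t)).comp x hxx.differentiableAt).add
      (((hG'd (xiVar x t)).comp x hxx.differentiableAt).const_mul _)
  have hPv : DifferentiableAt ℝ (fun x' => P (vstarFun P vbar x' t)) x :=
    (hPd (vstarFun P vbar x t)).comp x hvs
  have hwx : HasDerivAt (fun x' => P (vbar (xiVar x' t))) (W ξ * r⁻¹) x := by
    have h := (hw (xiVar x t)).comp x hxx
    rw [← hξ, ← hWq] at h
    exact h
  have hQx : HasDerivAt (fun x' => deriv P (vbar (xiVar x' t)) *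
        (vstarFun P vbar x' t - vbar (xiVar x' t)))
      ((1 + t)⁻¹ * (((1/2) * (G ξ + ξ * deriv G ξ)
        - (1/2) * (W ξ + ξ * (ξ / 2 * deriv vbar ξ))) * r⁻¹)) x := by
    have h := ((hQ (xiVar x t)).comp x hxx).const_mul (1 + t)⁻¹
    rw [← hξ] at h
    refine h.congr_of_eventuallyEq (Eventually.of_forall fun y => ?_)
    simp only [vstarFun, v1fun, Function.comp, ← hGdef]
    ring
  have hg2 : pdx (g2fun P vbar) x t = pdx (fun x' t' => P (vstarFun P vbar x' t')) x t
      - W ξ * r⁻¹ - (1 + t)⁻¹ * (((1/2) * (G ξ + ξ * deriv G ξ)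
        - (1/2) * (W ξ + ξ * (ξ / 2 * deriv vbar ξ))) * r⁻¹) := by
    unfold pdx
    exact ((hPv.hasDerivAt.sub hwx).sub hQx).deriv
  have hus : ustarFun P vbar x t
      = -(r⁻¹ * W ξ) + (r⁻¹) ^ 3 * (-(1/2) * (G ξ + ξ * deriv G ξ)) := by
    unfold ustarFun ubarFun
    rw [hp1, hp3, hu1, ← hξ]
  unfold Ssrc
  rw [hut, hg2, hus, hrs]
  field_simp
  ring
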